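/- (Monotonicity of the explicit method under a CFL condition.) Let A : ℝ → ℝ be nondecreasing and Lipschitz continuous with Lipschitz constant L_A and A(0) = 0, and let Δt > 0 satisfy the CFL condition Δt · L_A · |G^β_β| ≤ 1 for every β ∈ ℤ^d. Define, for bounded u : ℤ^d → ℝ, the explicit one-step map T(u)_α = u_α + Δt Σ_{β∈ℤ^d} G^α_β A(u_β). Then T is order preserving on bounded sequences: if u, v : ℤ^d → ℝ are bounded and u_α ≤ v_α for every α, then T(u)_α ≤ T(v)_α for every α. -/

import Mathlib

open MeasureTheory Set

noncomputable section

abbrev Ed (d : ℕ) := EuclideanSpace ℝ (Fin d)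

def cell (d : ℕ) (dx : ℝ) (α : Fin d → ℤ) : Set (Ed d) :=
  {x | ∀ i, dx * (α i : ℝ) < x i ∧ x i < dx * (α i : ℝ) + dx}

def ind (d : ℕ) (S : Set (Ed d)) : Ed d → ℝ :=
  S.indicator fun _ => 1

def gam (d : ℕ) (dx : ℝ) (μ : Measure (Ed d)) (l : Fin d) : ℝ :=
  - ∫ z in {z : Ed d | dx / 2 < ‖z‖ ∧ ‖z‖ ≤ 1}, z l ∂μ

def Dup (d : ℕ) (dx : ℝ) (μ : Measure (Ed d)) (l : Fin d) (φ : Ed d → ℝ) (x : Ed d) : ℝ :=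
  if 0 < gam d dx μ l then (φ (x + EuclideanSpace.single l dx) - φ x) / dx
  else (φ x - φ (x - EuclideanSpace.single l dx)) / dx

def Glow (d : ℕ) (dx : ℝ) (μ : Measure (Ed d)) (α β : Fin d → ℤ) : ℝ :=
  (dx ^ d)⁻¹ *
    ∫ x in cell d dx α, ∫ z in {z : Ed d | dx / 2 < ‖z‖},
      (ind d (cell d dx β) (x + z) - ind d (cell d dx β) x) ∂μ

def Gup (d : ℕ) (dx : ℝ) (μ : Measure (Ed d)) (α β : Fin d → ℤ) : ℝ :=
  (dx ^ d)⁻¹ *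
    ∑ l : Fin d, gam d dx μ l * ∫ x in cell d dx α, Dup d dx μ l (ind d (cell d dx β)) x

def Gw (d : ℕ) (dx : ℝ) (μ : Measure (Ed d)) (α β : Fin d → ℤ) : ℝ :=
  Glow d dx μ α β + Gup d dx μ α β

def GsplitLow (d : ℕ) (dx r : ℝ) (μ : Measure (Ed d)) (α β : Fin d → ℤ) : ℝ :=
  (dx ^ d)⁻¹ *
    ∫ x in cell d dx α, ∫ z in {z : Ed d | dx / 2 < ‖z‖ ∧ ‖z‖ ≤ r},
      (ind d (cell d dx β) (x + z) - ind d (cell d dx β) x) ∂μ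

def GsplitHigh (d : ℕ) (dx r : ℝ) (μ : Measure (Ed d)) (α β : Fin d → ℤ) : ℝ :=
  (dx ^ d)⁻¹ *
      ∫ x in cell d dx α, ∫ z in {z : Ed d | r < ‖z‖},
        (ind d (cell d dx β) (x + z) - ind d (cell d dx β) x) ∂μ
    + Gup d dx μ α β

def Aok (A : ℝ → ℝ) (LA : ℝ) : Prop :=
  Monotone A ∧ (∀ a b : ℝ, |A a - A b| ≤ LA * |a - b|) ∧ A 0 = 0

def SolvesImplicitStep (d : ℕ) (dx : ℝ) (μ : Measure (Ed d)) (A : ℝ → ℝ) (dt : ℝ)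
    (u h : (Fin d → ℤ) → ℝ) : Prop :=
  ∀ α, Summable (fun β => Gw d dx μ α β * A (u β)) ∧
    u α - dt * ∑' β, Gw d dx μ α β * A (u β) = h α

def Fractional (d : ℕ) (μ : Measure (Ed d)) (lam clam : ℝ) : Prop :=
  ∀ B : Set (Ed d), MeasurableSet B → B ⊆ {z : Ed d | 0 < ‖z‖ ∧ ‖z‖ < 1} →
    μ B ≤ ∫⁻ z in B, ENNReal.ofReal (clam * ‖z‖ ^ (-(d : ℝ) - lam))

def Lhat (d : ℕ) (dx : ℝ) (μ : Measure (Ed d)) (w : Ed d → ℝ) (x : Ed d) : ℝ :=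
  (∫ z in {z : Ed d | dx / 2 < ‖z‖}, (w (x + z) - w x) ∂μ) +
    ∑ l : Fin d, gam d dx μ l * Dup d dx μ l w x

def Ubar (d : ℕ) (dx : ℝ) (U : (Fin d → ℤ) → ℝ) (x : Ed d) : ℝ :=
  ∑' α : Fin d → ℤ, U α * ind d (cell d dx α) x

def cellAvg (d : ℕ) (dx : ℝ) (w : Ed d → ℝ) (x : Ed d) : ℝ :=
  ∑' α : Fin d → ℤ, Set.indicator (cell d dx α)
    (fun _ => (dx ^ d)⁻¹ * ∫ y in cell d dx α, w y) x


theorem measurableSet_cell (d : ℕ) (dx : ℝ) (α : Fin d → ℤ) : MeasurableSet (cell d dx α) := by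
  have h : cell d dx α = ⋂ i, {x : Ed d | dx * (α i : ℝ) < x i ∧ x i < dx * (α i : ℝ) + dx} := by
    ext x
    simp [cell]
  rw [h]
  refine MeasurableSet.iInter fun i => ?_
  have hm : Measurable fun x : Ed d => x i := by fun_prop
  exact (measurableSet_lt measurable_const hm).inter (measurableSet_lt hm measurable_const)

theorem disjoint_cell {d : ℕ} {dx : ℝ} (hdx : 0 < dx) {α β : Fin d → ℤ} (h : α ≠ β) :
    Disjoint (cell d dx α) (cell d dx β) := by
  rw [Set.disjoint_left]
  intro x hα hβ
  refine h (funext fun i => ?_)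
  have h1 : (α i : ℝ) < β i + 1 := by
    have := (hα i).1.trans (hβ i).2
    nlinarith
  have h2 : (β i : ℝ) < α i + 1 := by
    have := (hβ i).1.trans (hα i).2
    nlinarith
  have h3 : α i < β i + 1 := by exact_mod_cast h1
  have h4 : β i < α i + 1 := by exact_mod_cast h2
  omega

theorem volume_cell_lt_top (d : ℕ) (dx : ℝ) (α : Fin d → ℤ) : volume (cell d dx α) < ⊤ := by
  have h : cell d dx α = (WithLp.ofLp : Ed d → Fin d → ℝ) ⁻¹'
      (Set.univ.pi fun i => Ioo (dx * (α i : ℝ)) (dx * (α i : ℝ) + dx)) := by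
    ext x
    simp [cell]
  rw [h, (PiLp.volume_preserving_ofLp (Fin d)).measure_preimage
    (MeasurableSet.univ_pi fun i => measurableSet_Ioo).nullMeasurableSet, Real.volume_pi_Ioo]
  exact ENNReal.prod_lt_top fun i _ => ENNReal.ofReal_lt_top

/-- A measure integrating `min (‖z‖ ^ 2) 1` is finite away from the origin. -/
theorem measure_norm_gt_lt_top {d : ℕ} {r : ℝ} (hr : 0 < r) {μ : Measure (Ed d)}
    (hμ : ∫⁻ z, ENNReal.ofReal (min (‖z‖ ^ 2) 1) ∂μ < ⊤) :
    μ {z : Ed d | r < ‖z‖} < ⊤ := by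
  have hc : 0 < min (r ^ 2) 1 := by positivity
  have hm : AEMeasurable (fun z : Ed d => ENNReal.ofReal (min (‖z‖ ^ 2) 1)) μ := by fun_prop
  refine lt_of_le_of_lt (measure_mono fun z (hz : r < ‖z‖) => ?_)
    ((meas_ge_le_lintegral_div hm (ENNReal.ofReal_pos.2 hc).ne' ENNReal.ofReal_ne_top).trans_lt
      (ENNReal.div_lt_top hμ.ne (ENNReal.ofReal_pos.2 hc).ne'))
  exact ENNReal.ofReal_le_ofReal (min_le_min_right _ (by gcongr))

theorem summable_measureReal_cell {d : ℕ} {dx : ℝ} (hdx : 0 < dx) (ρ : Measure (Ed d))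
    [IsFiniteMeasure ρ] : Summable fun β : Fin d → ℤ => ρ.real (cell d dx β) := by
  refine summable_of_sum_le (c := ρ.real univ) (fun _ => measureReal_nonneg) fun s => ?_
  rw [← measureReal_biUnion_finset (fun a _ b _ hab => disjoint_cell hdx hab)
    fun b _ => measurableSet_cell d dx b]
  exact measureReal_mono (subset_univ _)

theorem integral_ind_comp {X : Type*} [MeasurableSpace X] {d : ℕ} (ρ : Measure X)
    {f : X → Ed d} (hf : Measurable f) {S : Set (Ed d)} (hS : MeasurableSet S) :
    ∫ x, ind d S (f x) ∂ρ = (ρ.map f).real S := by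
  rw [map_measureReal_apply hf hS, ← integral_indicator_one (hf hS)]
  rfl

theorem integrable_ind_comp {X : Type*} [MeasurableSpace X] {d : ℕ} (ρ : Measure X)
    [IsFiniteMeasure ρ] {f : X → Ed d} (hf : Measurable f) {S : Set (Ed d)}
    (hS : MeasurableSet S) : Integrable (fun x => ind d S (f x)) ρ :=
  (integrable_const (1 : ℝ)).indicator (hf hS)

theorem ind_nonneg (d : ℕ) (S : Set (Ed d)) (x : Ed d) : 0 ≤ ind d S x :=
  Set.indicator_nonneg (fun _ _ => zero_le_one) x

theorem ind_cell_eq_zero {d : ℕ} {dx : ℝ} (hdx : 0 < dx) {α β : Fin d → ℤ} (h : α ≠ β)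
    {x : Ed d} (hx : x ∈ cell d dx α) : ind d (cell d dx β) x = 0 :=
  Set.indicator_of_notMem (Set.disjoint_left.1 (disjoint_cell hdx h) hx) _

theorem summable_Glow {d : ℕ} {dx : ℝ} (hdx : 0 < dx) {μ : Measure (Ed d)}
    (hμ : ∫⁻ z, ENNReal.ofReal (min (‖z‖ ^ 2) 1) ∂μ < ⊤) (α : Fin d → ℤ) :
    Summable fun β => Glow d dx μ α β := by
  have : IsFiniteMeasure (volume.restrict (cell d dx α)) :=
    isFiniteMeasure_restrict.2 (volume_cell_lt_top d dx α).ne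
  have : IsFiniteMeasure (μ.restrict {z : Ed d | dx / 2 < ‖z‖}) :=
    isFiniteMeasure_restrict.2 (measure_norm_gt_lt_top (half_pos hdx) hμ).ne
  set ρ := (volume.restrict (cell d dx α)).prod (μ.restrict {z : Ed d | dx / 2 < ‖z‖})
  have hadd : Measurable fun p : Ed d × Ed d => p.1 + p.2 := by fun_prop
  refine (((summable_measureReal_cell hdx (ρ.map fun p => p.1 + p.2)).sub
    (summable_measureReal_cell hdx (ρ.map Prod.fst))).mul_left (dx ^ d)⁻¹).congr fun β => ?_
  have hβ := measurableSet_cell d dx β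
  have h1 := integrable_ind_comp ρ hadd hβ
  have h2 := integrable_ind_comp ρ measurable_fst hβ
  rw [← integral_ind_comp ρ hadd hβ, ← integral_ind_comp ρ measurable_fst hβ,
    ← integral_sub h1 h2]
  exact congrArg _ (integral_prod _ (h1.sub h2))

theorem summable_Gup {d : ℕ} {dx : ℝ} (hdx : 0 < dx) (μ : Measure (Ed d)) (α : Fin d → ℤ) :
    Summable fun β => Gup d dx μ α β := by
  have : IsFiniteMeasure (volume.restrict (cell d dx α)) :=
    isFiniteMeasure_restrict.2 (volume_cell_lt_top d dx α).ne
  set ρ := volume.restrict (cell d dx α)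
  refine (summable_sum fun l _ => Summable.mul_left _ ?_).mul_left _
  have key : ∀ f g : Ed d → Ed d, Measurable f → Measurable g → Summable fun β : Fin d → ℤ =>
      ∫ x, (ind d (cell d dx β) (f x) - ind d (cell d dx β) (g x)) / dx ∂ρ := by
    intro f g hf hg
    refine (((summable_measureReal_cell hdx (ρ.map f)).sub
      (summable_measureReal_cell hdx (ρ.map g))).div_const dx).congr fun β => ?_
    have hβ := measurableSet_cell d dx β
    rw [← integral_ind_comp ρ hf hβ, ← integral_ind_comp ρ hg hβ,
      ← integral_sub (integrable_ind_comp ρ hf hβ) (integrable_ind_comp ρ hg hβ), integral_div]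
  unfold Dup
  split_ifs
  · exact key _ _ (by fun_prop) (by fun_prop)
  · exact key _ _ (by fun_prop) (by fun_prop)

theorem summable_Gw {d : ℕ} {dx : ℝ} (hdx : 0 < dx) {μ : Measure (Ed d)}
    (hμ : ∫⁻ z, ENNReal.ofReal (min (‖z‖ ^ 2) 1) ∂μ < ⊤) (α : Fin d → ℤ) :
    Summable fun β => Gw d dx μ α β :=
  (summable_Glow hdx hμ α).add (summable_Gup hdx μ α)

theorem Gw_nonneg {d : ℕ} {dx : ℝ} (hdx : 0 < dx) (μ : Measure (Ed d)) {α β : Fin d → ℤ}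
    (h : α ≠ β) : 0 ≤ Gw d dx μ α β := by
  have hα := measurableSet_cell d dx α
  refine add_nonneg (mul_nonneg (by positivity) ?_) (mul_nonneg (by positivity) ?_)
  · refine setIntegral_nonneg hα fun x hx => integral_nonneg fun z => ?_
    simpa [ind_cell_eq_zero hdx h hx] using ind_nonneg d _ (x + z)
  · refine Finset.sum_nonneg fun l _ => ?_
    unfold Dup
    split_ifs with hl
    · refine mul_nonneg hl.le (setIntegral_nonneg hα fun x hx => div_nonneg ?_ hdx.le)
      simpa [ind_cell_eq_zero hdx h hx] using ind_nonneg d _ _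
    · refine mul_nonneg_of_nonpos_of_nonpos (not_lt.1 hl)
        (setIntegral_nonpos hα fun x hx => div_nonpos_of_nonpos_of_nonneg ?_ hdx.le)
      simpa [ind_cell_eq_zero hdx h hx] using ind_nonneg d _ _

theorem summable_Gw_mul {d : ℕ} {dx : ℝ} (hdx : 0 < dx) {μ : Measure (Ed d)}
    (hμ : ∫⁻ z, ENNReal.ofReal (min (‖z‖ ^ 2) 1) ∂μ < ⊤) (α : Fin d → ℤ)
    {w : (Fin d → ℤ) → ℝ} {C : ℝ} (hw : ∀ β, |w β| ≤ C) :
    Summable fun β => Gw d dx μ α β * w β := by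
  refine Summable.of_norm_bounded ((summable_Gw hdx hμ α).norm.mul_right C) fun β => ?_
  rw [norm_mul]
  exact mul_le_mul_of_nonneg_left (hw β) (norm_nonneg _)

theorem Aok.nonneg {A : ℝ → ℝ} {LA : ℝ} (hA : Aok A LA) : 0 ≤ LA := by
  simpa using (abs_nonneg _).trans (hA.2.1 1 0)

theorem Aok.abs_le {A : ℝ → ℝ} {LA : ℝ} (hA : Aok A LA) {a M : ℝ} (ha : |a| ≤ M) :
    |A a| ≤ LA * M := by
  have h := hA.2.1 a 0
  rw [hA.2.2, sub_zero, sub_zero] at h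
  exact h.trans (mul_le_mul_of_nonneg_left ha hA.nonneg)

theorem stmt8 (d : ℕ) (hd : 1 ≤ d) (dx : ℝ) (hdx0 : 0 < dx) (hdx1 : dx < 1)
    (μ : Measure (Ed d)) (hμ0 : μ {0} = 0)
    (hμfin : ∫⁻ z, ENNReal.ofReal (min (‖z‖ ^ 2) 1) ∂μ < ⊤)
    (A : ℝ → ℝ) (LA : ℝ) (hA : Aok A LA) (dt : ℝ) (hdt : 0 < dt)
    (hCFL : ∀ β : Fin d → ℤ, dt * LA * |Gw d dx μ β β| ≤ 1)
    (u v : (Fin d → ℤ) → ℝ)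
    (hu : ∃ M : ℝ, ∀ α, |u α| ≤ M) (hv : ∃ M : ℝ, ∀ α, |v α| ≤ M)
    (huv : ∀ α, u α ≤ v α) :
    ∀ α : Fin d → ℤ,
      u α + dt * ∑' β : Fin d → ℤ, Gw d dx μ α β * A (u β) ≤
        v α + dt * ∑' β : Fin d → ℤ, Gw d dx μ α β * A (v β) := by
  intro α
  obtain ⟨Mu, hMu⟩ := hu
  obtain ⟨Mv, hMv⟩ := hv
  have hsu := summable_Gw_mul hdx0 hμfin α fun β => hA.abs_le (hMu β)
  have hsv := summable_Gw_mul hdx0 hμfin α fun β => hA.abs_le (hMv β)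
  have hmono : ∀ β, 0 ≤ A (v β) - A (u β) := fun β => sub_nonneg.2 (hA.1 (huv β))
  have hdiag : Gw d dx μ α α * A (v α) - Gw d dx μ α α * A (u α) ≤
      ∑' β, Gw d dx μ α β * A (v β) - ∑' β, Gw d dx μ α β * A (u β) := by
    rw [← hsv.tsum_sub hsu]
    refine (hsv.sub hsu).le_tsum α fun β hβ => ?_
    rw [← mul_sub]
    exact mul_nonneg (Gw_nonneg hdx0 μ hβ.symm) (hmono β)
  have hlip : A (v α) - A (u α) ≤ LA * (v α - u α) := by
    have h := (le_abs_self _).trans (hA.2.1 (v α) (u α))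
    rwa [abs_of_nonneg (sub_nonneg.2 (huv α))] at h
  have hneg : -(|Gw d dx μ α α| * (A (v α) - A (u α))) ≤
      Gw d dx μ α α * (A (v α) - A (u α)) := by
    rw [← neg_mul]
    exact mul_le_mul_of_nonneg_right (neg_abs_le _) (hmono α)
  have hcfl : dt * (|Gw d dx μ α α| * (A (v α) - A (u α))) ≤ v α - u α := by
    calc dt * (|Gw d dx μ α α| * (A (v α) - A (u α)))
        ≤ dt * (|Gw d dx μ α α| * (LA * (v α - u α))) := by gcongr
      _ = dt * LA * |Gw d dx μ α α| * (v α - u α) := by ring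
      _ ≤ 1 * (v α - u α) :=
        mul_le_mul_of_nonneg_right (hCFL α) (sub_nonneg.2 (huv α))
      _ = v α - u α := one_mul _
  have hsum := mul_le_mul_of_nonneg_left hdiag hdt.le
  have hdt_neg := mul_le_mul_of_nonneg_left hneg hdt.le
  linarith
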